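/- arXiv:1206.0722 — 2 statements merged into one kernel-verified Lean document; each statement's English description precedes it below -/
import Mathlib

section
/- Let κ be a regular cardinal with κ ≥ ℵ₁, and let X be a T1 topological space with odL(X) ≤ κ and L(NL_κ(X)) ≤ κ. Then either L(X) ≤ κ, or X contains a clopen discrete subset of cardinality ≥ κ. -/
universe u

open Cardinal

/-- `OdLle X κ`: every cover of `X` by dense open sets has a subcover of
cardinality `< κ`. -/
def OdLle (X : Type u) [TopologicalSpace X] (κ : Cardinal.{u}) : Prop :=
  ∀ S : Set (Set X), (∀ U ∈ S, IsOpen U ∧ Dense U) → ⋃₀ S = Set.univ →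
    ∃ T ⊆ S, #T < κ ∧ ⋃₀ T = Set.univ

/-- `Lle X κ`: every open cover of `X` has a subcover of cardinality `< κ`. -/
def Lle (X : Type u) [TopologicalSpace X] (κ : Cardinal.{u}) : Prop :=
  ∀ S : Set (Set X), (∀ U ∈ S, IsOpen U) → ⋃₀ S = Set.univ →
    ∃ T ⊆ S, #T < κ ∧ ⋃₀ T = Set.univ

/-- `LinLle X κ`: every open cover of `X` that is a chain under inclusion has a
subcover of cardinality `< κ`. -/
def LinLle (X : Type u) [TopologicalSpace X] (κ : Cardinal.{u}) : Prop :=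
  ∀ S : Set (Set X), (∀ U ∈ S, IsOpen U) → IsChain (· ⊆ ·) S → ⋃₀ S = Set.univ →
    ∃ T ⊆ S, #T < κ ∧ ⋃₀ T = Set.univ

/-- `OdCompact X`: every cover of `X` by dense open sets has a finite subcover. -/
def OdCompact (X : Type u) [TopologicalSpace X] : Prop :=
  ∀ S : Set (Set X), (∀ U ∈ S, IsOpen U ∧ Dense U) → ⋃₀ S = Set.univ →
    ∃ T ⊆ S, T.Finite ∧ ⋃₀ T = Set.univ

open Set

/-- `A` is covered by fewer than `κ` members of the family `S`. -/
def CoveredByLT {X : Type u} (S : Set (Set X)) (κ : Cardinal.{u}) (A : Set X) : Prop :=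
  ∃ T ⊆ S, #T < κ ∧ A ⊆ ⋃₀ T

section CoveredByLT

variable {X : Type u} {S : Set (Set X)} {κ : Cardinal.{u}} {A B : Set X}

theorem CoveredByLT.mono (h : CoveredByLT S κ B) (hAB : A ⊆ B) : CoveredByLT S κ A := by
  obtain ⟨T, hT, hc, hB⟩ := h
  exact ⟨T, hT, hc, hAB.trans hB⟩

theorem CoveredByLT.union (hκ : ℵ₀ ≤ κ) (hA : CoveredByLT S κ A) (hB : CoveredByLT S κ B) :
    CoveredByLT S κ (A ∪ B) := by
  obtain ⟨T, hT, hc, hA⟩ := hA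
  obtain ⟨T', hT', hc', hB⟩ := hB
  refine ⟨T ∪ T', union_subset hT hT',
    (mk_union_le _ _).trans_lt (add_lt_of_lt hκ hc hc'), ?_⟩
  rw [sUnion_union]
  exact union_subset_union hA hB

theorem CoveredByLT.iUnion (hκ : κ.IsRegular) {ι : Type u} (hι : #ι < κ) {A : ι → Set X}
    (h : ∀ i, CoveredByLT S κ (A i)) : CoveredByLT S κ (⋃ i, A i) := by
  choose T hT hc hA using h
  refine ⟨⋃ i, T i, iUnion_subset hT,
    (card_iUnion_lt_iff_forall_of_isRegular hκ hι).2 hc, ?_⟩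
  refine iUnion_subset fun i ↦ (hA i).trans (sUnion_subset_sUnion (subset_iUnion T i))

theorem coveredByLT_of_card_lt (hκ : κ.IsRegular) (hS : ⋃₀ S = Set.univ) (hA : #A < κ) :
    CoveredByLT S κ A := by
  have h : CoveredByLT S κ (⋃ a : A, {(a : X)}) := by
    refine CoveredByLT.iUnion hκ hA fun a ↦ ?_
    obtain ⟨s, hs, has⟩ : (a : X) ∈ ⋃₀ S := hS ▸ mem_univ _
    refine ⟨{s}, singleton_subset_iff.2 hs, ?_, by simpa using has⟩
    rw [mk_singleton]
    exact one_lt_aleph0.trans_le hκ.aleph0_le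
  exact h.mono fun a ha ↦ mem_iUnion.2 ⟨⟨a, ha⟩, rfl⟩

theorem coveredByLT_of_subset_image {Y : Type u} {f : Set X → Set Y} {R : Set (Set Y)}
    (hR : R ⊆ f '' S) (hc : #R < κ) (hA : ∀ T ⊆ S, R ⊆ f '' T → A ⊆ ⋃₀ T) :
    CoveredByLT S κ A := by
  choose g hgS hg using fun r : R ↦ hR r.2
  refine ⟨range g, range_subset_iff.2 hgS, mk_range_le.trans_lt hc,
    hA _ (range_subset_iff.2 hgS) fun r hr ↦ ⟨_, ⟨⟨r, hr⟩, rfl⟩, hg ⟨r, hr⟩⟩⟩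

theorem coveredByLT_empty (hκ : 0 < κ) : CoveredByLT S κ (∅ : Set X) :=
  ⟨∅, empty_subset _, by simpa using hκ, empty_subset _⟩

variable [TopologicalSpace X]

/-- A relatively closed subset of a subspace `U` with `Lle U κ` is covered by fewer than `κ`
members of any open family covering it. -/
theorem Lle.coveredByLT_inter {U C : Set X} (hU : Lle U κ) (hκ : 0 < κ) (hC : IsClosed C)
    (hSo : ∀ s ∈ S, IsOpen s) (hS : C ∩ U ⊆ ⋃₀ S) : CoveredByLT S κ (C ∩ U) := by
  rcases (C ∩ U).eq_empty_or_nonempty with h | ⟨x₀, hx₀⟩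
  · rw [h]
    exact coveredByLT_empty hκ
  obtain ⟨s₀, hs₀, -⟩ := hS hx₀
  obtain ⟨R, hR, hc, hRu⟩ := hU ((fun s ↦ (Subtype.val ⁻¹' (s ∪ Cᶜ) : Set U)) '' S) (by
      rintro _ ⟨s, hs, rfl⟩
      exact ((hSo s hs).union hC.isOpen_compl).preimage continuous_subtype_val) (by
      refine eq_univ_of_forall fun x ↦ ?_
      by_cases hx : (x : X) ∈ C
      · obtain ⟨s, hs, hxs⟩ := hS ⟨hx, x.2⟩
        exact ⟨_, ⟨s, hs, rfl⟩, Or.inl hxs⟩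
      · exact ⟨_, ⟨s₀, hs₀, rfl⟩, Or.inr hx⟩)
  refine coveredByLT_of_subset_image hR hc fun T _ hT x hx ↦ ?_
  obtain ⟨r, hr, hxr⟩ : (⟨x, hx.2⟩ : U) ∈ ⋃₀ R := hRu ▸ mem_univ _
  obtain ⟨s, hs, rfl⟩ := hT hr
  exact ⟨s, hs, hxr.resolve_right fun h ↦ h hx.1⟩

/-- If `OdLle X κ`, then a closed set with empty interior is covered by fewer than `κ` members
of any open family covering it. -/
theorem OdLle.coveredByLT {N : Set X} (hX : OdLle X κ) (hκ : 0 < κ) (hN : IsClosed N)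
    (hNi : interior N = ∅) (hSo : ∀ s ∈ S, IsOpen s) (hS : N ⊆ ⋃₀ S) : CoveredByLT S κ N := by
  rcases N.eq_empty_or_nonempty with rfl | ⟨x₀, hx₀⟩
  · exact coveredByLT_empty hκ
  obtain ⟨s₀, hs₀, -⟩ := hS hx₀
  obtain ⟨R, hR, hc, hRu⟩ := hX ((fun s ↦ s ∪ Nᶜ) '' S) (by
      rintro _ ⟨s, hs, rfl⟩
      exact ⟨(hSo s hs).union hN.isOpen_compl,
        (interior_eq_empty_iff_dense_compl.1 hNi).mono subset_union_right⟩) (by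
      refine eq_univ_of_forall fun x ↦ ?_
      by_cases hx : x ∈ N
      · obtain ⟨s, hs, hxs⟩ := hS hx
        exact ⟨_, ⟨s, hs, rfl⟩, Or.inl hxs⟩
      · exact ⟨_, ⟨s₀, hs₀, rfl⟩, Or.inr hx⟩)
  refine coveredByLT_of_subset_image hR hc fun T _ hT x hx ↦ ?_
  obtain ⟨r, hr, hxr⟩ : x ∈ ⋃₀ R := hRu ▸ mem_univ _
  obtain ⟨s, hs, rfl⟩ := hT hr
  exact ⟨s, hs, hxr.resolve_right fun h ↦ h hx⟩

/-- If `OdLle X κ`, then a closed set of non-isolated points contained in the union of a disjoint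
open family meets fewer than `κ` members of that family. -/
theorem OdLle.card_meeting_lt [T1Space X] {V : Set (Set X)} {G : Set X} (hX : OdLle X κ)
    (hκ : 0 < κ) (hVo : ∀ v ∈ V, IsOpen v) (hVd : V.PairwiseDisjoint id) (hG : IsClosed G)
    (hGi : ∀ x ∈ G, ¬ IsOpen {x}) (hGV : G ⊆ ⋃₀ V) :
    #{v ∈ V | (G ∩ v).Nonempty} < κ := by
  set M : Set (Set X) := {v ∈ V | (G ∩ v).Nonempty}
  choose p hpG hpv using fun v : M ↦ v.2.2
  have huniq : ∀ (v : M) (w : Set X), w ∈ V → p v ∈ w → (v : Set X) = w := fun v w hw hpw ↦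
    hVd.elim_set v.2.1 hw (p v) (hpv v) hpw
  have hclosed : IsClosed (range p) := by
    rw [← isOpen_compl_iff, isOpen_iff_forall_mem_open]
    intro y hy
    by_cases hyG : y ∈ G
    · obtain ⟨v, hv, hyv⟩ := hGV hyG
      let v' : M := ⟨v, hv, y, hyG, hyv⟩
      refine ⟨v \ {p v'}, ?_, (hVo v hv).sdiff isClosed_singleton, hyv, fun h ↦ hy ⟨v', h.symm⟩⟩
      rintro _ ⟨hzv, hz⟩ ⟨w, rfl⟩
      obtain rfl : w = v' := Subtype.ext (huniq w v hv hzv)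
      exact hz rfl
    · refine ⟨Gᶜ, ?_, hG.isOpen_compl, hyG⟩
      rintro _ hz ⟨w, rfl⟩
      exact hz (hpG w)
  have hint : interior (range p) = ∅ := by
    refine eq_empty_of_forall_notMem fun y hy ↦ ?_
    obtain ⟨v, rfl⟩ := interior_subset hy
    refine hGi _ (hpG v) ?_
    convert isOpen_interior.inter (hVo v v.2.1) using 1
    refine Subset.antisymm (singleton_subset_iff.2 ⟨hy, hpv v⟩) ?_
    rintro z ⟨hz, hzv⟩
    obtain ⟨w, rfl⟩ := interior_subset hz
    rw [Subtype.ext (huniq w v v.2.1 hzv)]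
    rfl
  obtain ⟨T, hTM, hTc, hT⟩ := hX.coveredByLT hκ hclosed hint (S := M) (fun v hv ↦ hVo v hv.1)
    (range_subset_iff.2 fun v ↦ ⟨v, v.2, hpv v⟩)
  refine (mk_le_mk_of_subset fun v hv ↦ ?_).trans_lt hTc
  obtain ⟨t, ht, hpt⟩ := hT ⟨⟨v, hv⟩, rfl⟩
  obtain rfl : v = t := huniq ⟨v, hv⟩ t (hTM ht).1 hpt
  exact ht

/-- There is a disjoint family of open sets with a given property that meets every nonempty open
set with that property. -/
theorem exists_disjoint_open_family (P : Set X → Prop) :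
    ∃ V : Set (Set X), (∀ v ∈ V, IsOpen v ∧ P v) ∧ V.PairwiseDisjoint id ∧
      ∀ o, IsOpen o → P o → Disjoint o (⋃₀ V) → o = ∅ := by
  obtain ⟨V, hV⟩ := zorn_subset {V : Set (Set X) | (∀ v ∈ V, IsOpen v ∧ P v) ∧
    V.PairwiseDisjoint id} (by
      intro c hc hchain
      refine ⟨⋃₀ c, ⟨?_, ?_⟩, fun s hs ↦ subset_sUnion_of_mem hs⟩
      · rintro v ⟨W, hW, hv⟩
        exact (hc hW).1 v hv
      · exact (pairwise_sUnion hchain.directedOn).2 fun W hW ↦ (hc hW).2)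
  refine ⟨V, hV.prop.1, hV.prop.2, fun o ho hP hd ↦ ?_⟩
  have hins : insert o V ⊆ V := hV.le_of_ge ⟨?_, ?_⟩ (subset_insert o V)
  · exact disjoint_self.1 (hd.mono_right (subset_sUnion_of_mem (hins (mem_insert o V))))
  · rintro v (rfl | hv)
    exacts [⟨ho, hP⟩, hV.prop.1 v hv]
  · exact hV.prop.2.insert fun v hv _ ↦ hd.mono_right (subset_sUnion_of_mem hv)

/-- If `OdLle X κ`, then a closed set of non-isolated points, each with an open neighborhood `U`
such that `Lle U κ`, is covered by fewer than `κ` members of any open cover of `X`. -/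
theorem OdLle.coveredByLT_of_locally [T1Space X] {G : Set X} (hX : OdLle X κ)
    (hκ : κ.IsRegular) (hG : IsClosed G) (hGi : ∀ x ∈ G, ¬ IsOpen {x})
    (hGL : ∀ x ∈ G, ∃ U : Set X, IsOpen U ∧ x ∈ U ∧ Lle U κ)
    (hSo : ∀ s ∈ S, IsOpen s) (hS : ⋃₀ S = Set.univ) : CoveredByLT S κ G := by
  have hpos : 0 < κ := aleph0_pos.trans_le hκ.aleph0_le
  have hSA : ∀ A : Set X, A ⊆ ⋃₀ S := fun A ↦ (subset_univ A).trans hS.ge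
  obtain ⟨V, hV, hVd, hVmax⟩ := exists_disjoint_open_family
    fun v : Set X ↦ ∃ U : Set X, v ⊆ U ∧ Lle U κ
  have hVo : ∀ v ∈ V, IsOpen v := fun v hv ↦ (hV v hv).1
  have hN : CoveredByLT S κ (G \ ⋃₀ V) := by
    refine hX.coveredByLT hpos (hG.sdiff (isOpen_sUnion hVo)) ?_ hSo (hSA _)
    refine eq_empty_of_forall_notMem fun y hy ↦ ?_
    obtain ⟨U, hUo, hyU, hU⟩ := hGL y (interior_subset hy).1
    have hempty := hVmax _ (isOpen_interior.inter hUo) ⟨U, inter_subset_right, hU⟩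
      (disjoint_left.2 fun z hz ↦ (interior_subset hz.1 : z ∈ G \ ⋃₀ V).2)
    exact (hempty ▸ (⟨hy, hyU⟩ : y ∈ interior (G \ ⋃₀ V) ∩ U) : y ∈ (∅ : Set X))
  obtain ⟨T, hTS, hTc, hT⟩ := hN
  set H : Set X := G \ ⋃₀ T
  have hHc : IsClosed H := hG.sdiff (isOpen_sUnion fun t ht ↦ hSo t (hTS ht))
  have hHV : H ⊆ ⋃₀ V := fun x hx ↦ by_contra fun h ↦ hx.2 (hT ⟨hx.1, h⟩)
  have hcard := hX.card_meeting_lt hpos hVo hVd hHc (fun x hx ↦ hGi x hx.1) hHV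
  have hHcov : CoveredByLT S κ (⋃ v : {v ∈ V | (H ∩ v).Nonempty}, H ∩ v) := by
    refine CoveredByLT.iUnion hκ hcard fun ⟨v, hv, _⟩ ↦ ?_
    obtain ⟨U, hvU, hU⟩ := (hV v hv).2
    have hclosed : IsClosed (H \ ⋃₀ (V \ {v})) :=
      hHc.sdiff (isOpen_sUnion fun w hw ↦ hVo w hw.1)
    refine (hU.coveredByLT_inter hpos hclosed hSo (hSA _)).mono ?_
    rintro x ⟨hxH, hxv⟩
    refine ⟨⟨hxH, ?_⟩, hvU hxv⟩
    rintro ⟨w, ⟨hw, hwv⟩, hxw⟩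
    exact hwv (hVd.elim_set hw hv x hxw hxv)
  refine (CoveredByLT.union hκ.aleph0_le ⟨T, hTS, hTc, Subset.rfl⟩ hHcov).mono fun x hx ↦ ?_
  by_cases hxT : x ∈ ⋃₀ T
  · exact Or.inl hxT
  · obtain ⟨v, hv, hxv⟩ := hHV ⟨hx, hxT⟩
    exact Or.inr (mem_iUnion.2 ⟨⟨v, hv, x, ⟨hx, hxT⟩, hxv⟩, ⟨hx, hxT⟩, hxv⟩)

end CoveredByLT

theorem stmt_11 (X : Type u) [TopologicalSpace X] [T1Space X]
    (κ : Cardinal.{u}) (hκreg : κ.IsRegular) (hκ : Cardinal.aleph 1 ≤ κ)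
    (hod : OdLle X κ)
    (hNL : Lle ({x : X | ¬ ∃ U : Set X, IsOpen U ∧ x ∈ U ∧ Lle U κ} : Set X) κ) :
    Lle X κ ∨ ∃ D : Set X, IsClopen D ∧ DiscreteTopology D ∧ κ ≤ #D := by
  refine or_iff_not_imp_right.2 fun hD S hSo hS ↦ ?_
  have hpos : 0 < κ := aleph0_pos.trans_le hκreg.aleph0_le
  set I : Set X := {x | IsOpen {x}}
  have hIsub : ∀ A ⊆ I, IsOpen A := fun A hA ↦ by
    rw [← biUnion_of_singleton A]
    exact isOpen_biUnion fun x hx ↦ hA hx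
  obtain ⟨T, hTS, hTc, hT⟩ := hNL.coveredByLT_inter hpos isClosed_univ hSo
    ((subset_univ _).trans hS.ge)
  have hTo : IsOpen (⋃₀ T) := isOpen_sUnion fun t ht ↦ hSo t (hTS ht)
  obtain ⟨T', hTS', hTc', hT'⟩ := hod.coveredByLT_of_locally hκreg
    (hTo.isClosed_compl.sdiff (hIsub I Subset.rfl)) (fun x hx ↦ hx.2)
    (fun x hx ↦ by_contra fun h ↦ hx.1 (hT ⟨mem_univ x, h⟩)) hSo hS
  have hTo' : IsOpen (⋃₀ T') := isOpen_sUnion fun t ht ↦ hSo t (hTS' ht)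
  set D : Set X := (⋃₀ T)ᶜ \ ⋃₀ T'
  have hDI : D ⊆ I := fun x hx ↦ by_contra fun h ↦ hx.2 (hT' ⟨hx.1, h⟩)
  have hDc : #D < κ := by
    by_contra! hle
    refine hD ⟨D, ⟨hTo.isClosed_compl.sdiff hTo', hIsub D hDI⟩, ?_, hle⟩
    refine discreteTopology_iff_isOpen_singleton.2 fun x ↦ ?_
    convert (hDI x.2 : IsOpen {(x : X)}).preimage continuous_subtype_val using 1
    ext y
    simp [Subtype.ext_iff]
  obtain ⟨R, hRS, hRc, hR⟩ := ((CoveredByLT.union hκreg.aleph0_le ⟨T, hTS, hTc, Subset.rfl⟩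
    ⟨T', hTS', hTc', Subset.rfl⟩).union hκreg.aleph0_le (coveredByLT_of_card_lt hκreg hS hDc))
  refine ⟨R, hRS, hRc, eq_univ_of_forall fun x ↦ hR ?_⟩
  by_cases h : x ∈ ⋃₀ T
  · exact Or.inl (Or.inl h)
  by_cases h' : x ∈ ⋃₀ T'
  · exact Or.inl (Or.inr h')
  · exact Or.inr ⟨h, h'⟩
end

section
/- Let X be a T1 od-compact topological space, Y a topological space, and f : X → Y a continuous closed surjective map. Then Y is od-compact. -/
universe u

open Cardinal

/-- In an od-compact space, every closed set with empty interior is compact. -/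
theorem OdCompact.isCompact_of_interior_eq_empty {X : Type u} [TopologicalSpace X]
    (hX : OdCompact X) {K : Set X} (hK : IsClosed K) (hint : interior K = ∅) :
    IsCompact K := by
  classical
  rcases K.eq_empty_or_nonempty with rfl | ⟨a, ha⟩
  · exact isCompact_empty
  refine isCompact_of_finite_subcover fun {ι} U hU hcover => ?_
  have hdense : Dense Kᶜ := interior_eq_empty_iff_dense_compl.mp hint
  obtain ⟨T, hTS, hTfin, hT⟩ := hX (Set.range fun i => U i ∪ Kᶜ)
    (by
      rintro _ ⟨i, rfl⟩
      exact ⟨(hU i).union hK.isOpen_compl, hdense.mono Set.subset_union_right⟩)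
    (by
      refine Set.eq_univ_of_forall fun x => ?_
      by_cases hx : x ∈ K
      · obtain ⟨i, hi⟩ := Set.mem_iUnion.mp (hcover hx)
        exact ⟨_, ⟨i, rfl⟩, Or.inl hi⟩
      · obtain ⟨i, -⟩ := Set.mem_iUnion.mp (hcover ha)
        exact ⟨_, ⟨i, rfl⟩, Or.inr hx⟩)
  lift T to Finset (Set X) using hTfin
  rw [← Set.image_univ, Finset.subset_set_image_iff] at hTS
  obtain ⟨t, -, rfl⟩ := hTS
  refine ⟨t, fun x hx => ?_⟩
  obtain ⟨_, hV, hxV⟩ := Set.mem_sUnion.mp (hT.symm ▸ Set.mem_univ x)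
  obtain ⟨i, hi, rfl⟩ := Finset.mem_image.mp (Finset.mem_coe.mp hV)
  exact Set.mem_biUnion hi (hxV.resolve_right fun h => h hx)

/-- Under a closed surjection, a set with empty interior is the image of the points of its
preimage that do not lie in the interior of the preimage. -/
theorem IsClosedMap.subset_image_preimage_diff_interior {X Y : Type*} [TopologicalSpace X]
    [TopologicalSpace Y] {f : X → Y} (hclosed : IsClosedMap f)
    (hsurj : Function.Surjective f) {F : Set Y} (hint : interior F = ∅) :
    F ⊆ f '' (f ⁻¹' F \ interior (f ⁻¹' F)) := by
  intro y hy
  by_contra hne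
  have hyC : y ∉ f '' (interior (f ⁻¹' F))ᶜ := by
    rintro ⟨x, hx, rfl⟩
    exact hne ⟨x, ⟨hy, hx⟩, rfl⟩
  have hsub : (f '' (interior (f ⁻¹' F))ᶜ)ᶜ ⊆ F := by
    intro z hz
    obtain ⟨x, rfl⟩ := hsurj z
    by_contra hzF
    exact hz ⟨x, fun hx => hzF (interior_subset (s := f ⁻¹' F) hx), rfl⟩
  have hopen : IsOpen (f '' (interior (f ⁻¹' F))ᶜ)ᶜ :=
    (hclosed _ isOpen_interior.isClosed_compl).isOpen_compl
  have hmem : y ∈ interior F := interior_maximal hsub hopen hyC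
  simp [hint] at hmem

theorem stmt_17 (X : Type u) (Y : Type v) [TopologicalSpace X] [TopologicalSpace Y]
    [T1Space X] (hX : OdCompact X)
    (f : X → Y) (hf : Continuous f) (hclosed : IsClosedMap f)
    (hsurj : Function.Surjective f) :
    OdCompact Y := by
  intro S hS hcover
  rcases S.eq_empty_or_nonempty with rfl | ⟨U, hU⟩
  · exact ⟨∅, subset_rfl, Set.finite_empty, hcover⟩
  have hUc : IsClosed Uᶜ := (hS U hU).1.isClosed_compl
  have hint : interior Uᶜ = ∅ := (hS U hU).2.interior_compl
  have hpre : IsClosed (f ⁻¹' Uᶜ) := hUc.preimage hf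
  have hcompact : IsCompact (f '' frontier (f ⁻¹' Uᶜ)) :=
    (hX.isCompact_of_interior_eq_empty isClosed_frontier (interior_frontier hpre)).image hf
  obtain ⟨T, hTS, hTfin, hT⟩ := hcompact.elim_finite_subcover_image (b := S) (c := id)
    (fun V hV => (hS V hV).1)
    (by simp [← Set.sUnion_eq_biUnion, hcover])
  refine ⟨insert U T, Set.insert_subset hU hTS, hTfin.insert U, Set.eq_univ_of_forall fun y => ?_⟩
  by_cases hy : y ∈ U
  · exact ⟨U, Set.mem_insert _ _, hy⟩
  · have hyF := hclosed.subset_image_preimage_diff_interior hsurj hint hy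
    rw [← hpre.frontier_eq] at hyF
    obtain ⟨V, hV, hyV⟩ := Set.mem_iUnion₂.mp (hT hyF)
    exact ⟨V, Set.mem_insert_of_mem _ hV, hyV⟩
end
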